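/- Approximation of p-linear maps on finite-dimensional spaces: let Φ : F → Y be a p-linear map with constant K, F finite-dimensional. For each ε > 0 there exists a homogeneous map Φ' : F → Y such that ‖Φ(f) − Φ'(f)‖ ≤ (1+ε)K‖f‖ for all f, the image of Φ' spans a finite-dimensional subspace of Y, and Φ' is p-linear with constant at most 3^(1/p)(1+ε)K. -/

import Mathlib

open scoped BigOperators

/-- A real function that is subadditive after raising to the power `p` is so on finite sums. -/
theorem rpow_sum_le_sum_rpow {E ι : Type*} [AddCommGroup E] {N : E → ℝ} {p : ℝ} (hp : 0 < p)
    (hN0 : N 0 = 0) (hNp : ∀ x x', N (x + x') ^ p ≤ N x ^ p + N x' ^ p)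
    (s : Finset ι) (x : ι → E) : N (∑ i ∈ s, x i) ^ p ≤ ∑ i ∈ s, N (x i) ^ p :=
  Finset.le_sum_of_subadditive (fun v => N v ^ p)
    (by simp [hN0, Real.zero_rpow hp.ne']) hNp s x

/-- Pointwise approximation of a homogeneous map by elements of a subspace can be made
homogeneous. -/
theorem exists_homogeneous_approx {F Y : Type*} [AddCommGroup F] [Module ℝ F]
    [AddCommGroup Y] [Module ℝ Y] {NF : F → ℝ} {NY : Y → ℝ} {C : ℝ}
    (hNF : ∀ (c : ℝ) (x : F), NF (c • x) = |c| * NF x)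
    (hNY : ∀ (c : ℝ) (y : Y), NY (c • y) = |c| * NY y)
    {Φ : F → Y} (hΦ : ∀ (c : ℝ) (x : F), Φ (c • x) = c • Φ x) (W : Submodule ℝ Y)
    (h : ∀ v, ∃ y ∈ W, NY (Φ v - y) ≤ C * NF v) :
    ∃ Φ' : F → Y, (∀ (c : ℝ) (x : F), Φ' (c • x) = c • Φ' x) ∧
      (∀ f, NY (Φ f - Φ' f) ≤ C * NF f) ∧ ∀ f, Φ' f ∈ W := by
  classical
  choose ψ hψW hψ using h
  have hrep : ∀ f : F, ∃ a : ℝ, ∀ hf : f ≠ 0, a • (Projectivization.mk ℝ f hf).rep = f := by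
    intro f
    by_cases hf : f = 0
    · exact ⟨0, fun h => absurd hf h⟩
    · obtain ⟨a, ha⟩ := Projectivization.exists_smul_eq_mk_rep ℝ f hf
      refine ⟨(a⁻¹ : ℝˣ), fun _ => ?_⟩
      rw [← ha, ← Units.smul_def, inv_smul_smul]
  choose a ha using hrep
  have hNF0 : NF 0 = 0 := by simpa using hNF 0 0
  have hNY0 : NY 0 = 0 := by simpa using hNY 0 0
  have hΦ0 : Φ 0 = 0 := by simpa using hΦ 0 0
  refine ⟨fun f => if hf : f = 0 then 0 else a f • ψ (Projectivization.mk ℝ f hf).rep, ?_, ?_, ?_⟩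
  · intro c x
    by_cases hc : c = 0
    · simp [hc]
    by_cases hx : x = 0
    · simp [hx]
    have hcx : c • x ≠ 0 := smul_ne_zero hc hx
    have hmk : Projectivization.mk ℝ (c • x) hcx = Projectivization.mk ℝ x hx :=
      (Projectivization.mk_eq_mk_iff' ℝ _ _ hcx hx).2 ⟨c, rfl⟩
    have hax : a (c • x) = c * a x := by
      have h1 := ha (c • x) hcx
      rw [hmk] at h1
      have h2 : (c * a x) • (Projectivization.mk ℝ x hx).rep = c • x := by
        rw [mul_smul, ha x hx]
      exact smul_left_injective ℝ (Projectivization.rep_nonzero _) (h1.trans h2.symm)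
    simp only [dif_neg hcx, dif_neg hx, hmk, hax, mul_smul]
  · intro f
    by_cases hf : f = 0
    · simp [hf, hΦ0, hNY0, hNF0]
    · simp only [dif_neg hf]
      generalize hr : (Projectivization.mk ℝ f hf).rep = r
      have hfr : f = a f • r := by rw [← hr, ha f hf]
      have h1 : Φ f - a f • ψ r = a f • (Φ r - ψ r) := by
        rw [smul_sub, ← hΦ, ← hfr]
      have h2 : NF f = |a f| * NF r := by rw [← hNF, ← hfr]
      rw [h1, hNY, h2]
      calc |a f| * NY (Φ r - ψ r) ≤ |a f| * (C * NF r) :=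
            mul_le_mul_of_nonneg_left (hψ r) (abs_nonneg _)
        _ = C * (|a f| * NF r) := by ring
  · intro f
    by_cases hf : f = 0
    · simp [hf]
    · simp only [dif_neg hf]
      exact W.smul_mem _ (hψW _)

/-- For a `p`-norm on a finite-dimensional space with basis `b`, finitely many vectors suffice to
write every `v` as a multiple of one of them plus a combination of basis vectors, at the cost of a
factor `1 + δ` in the `p`-th powers. -/
theorem exists_finite_net_basis {F ι : Type*} [AddCommGroup F] [Module ℝ F] [Fintype ι]
    (b : Module.Basis ι ℝ F) {NF : F → ℝ} {p δ : ℝ} (hp : 0 < p) (hδ : 0 < δ)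
    (hNF0 : ∀ x, 0 ≤ NF x) (hNFdef : ∀ x, NF x = 0 ↔ x = 0)
    (hNFhom : ∀ (c : ℝ) (x : F), NF (c • x) = |c| * NF x)
    (hNFp : ∀ x x', NF (x + x') ^ p ≤ NF x ^ p + NF x' ^ p) :
    ∃ T : Set F, T.Finite ∧ ∀ v, v ≠ 0 → ∃ (t : ℝ) (g : F) (c : ι → ℝ), g ∈ T ∧
      v = t • g + ∑ j, c j • b j ∧
      NF (t • g) ^ p + ∑ j, NF (c j • b j) ^ p ≤ (1 + δ) * NF v ^ p := by
  classical
  set L := b.equivFun.symm with hL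
  have hLapp : ∀ x : ι → ℝ, L x = ∑ j, x j • b j := fun x => b.equivFun_symm_apply x
  set M : ℝ := ∑ j, NF (b j) ^ p with hM
  have hM0 : 0 ≤ M := Finset.sum_nonneg fun j _ => Real.rpow_nonneg (hNF0 _) _
  have hsum : ∀ (x : ι → ℝ) (r : ℝ), ‖x‖ ≤ r → ∑ j, NF (x j • b j) ^ p ≤ M * r ^ p := by
    intro x r hx
    rw [hM, Finset.sum_mul]
    refine Finset.sum_le_sum fun j _ => ?_
    rw [hNFhom, Real.mul_rpow (abs_nonneg _) (hNF0 _), mul_comm]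
    refine mul_le_mul_of_nonneg_left ?_ (Real.rpow_nonneg (hNF0 _) _)
    exact Real.rpow_le_rpow (abs_nonneg _) ((norm_le_pi_norm x j).trans hx) hp.le
  have hle : ∀ x : ι → ℝ, NF (L x) ^ p ≤ M * ‖x‖ ^ p := fun x => by
    rw [hLapp]
    exact (rpow_sum_le_sum_rpow hp ((hNFdef 0).2 rfl) hNFp _ _).trans (hsum x _ le_rfl)
  have hdiff : ∀ x y : ι → ℝ, NF (L x) ^ p - NF (L y) ^ p ≤ M * ‖x - y‖ ^ p := fun x y => by
    have h1 := hNFp (L (x - y)) (L y)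
    rw [← map_add, sub_add_cancel] at h1
    linarith [hle (x - y)]
  have hcont : Continuous fun x : ι → ℝ => NF (L x) ^ p := by
    rw [continuous_iff_continuousAt]
    intro x
    rw [ContinuousAt, tendsto_iff_dist_tendsto_zero]
    have hlim : Filter.Tendsto (fun y : ι → ℝ => M * ‖y - x‖ ^ p) (nhds x) (nhds 0) := by
      have hc : Continuous fun y : ι → ℝ => M * ‖y - x‖ ^ p :=
        continuous_const.mul ((continuous_id.sub continuous_const).norm.rpow_const
          fun _ => Or.inr hp.le)
      simpa [Real.zero_rpow hp.ne'] using hc.tendsto x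
    refine squeeze_zero (fun _ => dist_nonneg) (fun y => ?_) hlim
    rw [Real.dist_eq, abs_le]
    have h1 := hdiff x y
    rw [norm_sub_rev] at h1
    exact ⟨by linarith, hdiff y x⟩
  have hS : IsCompact (Metric.sphere (0 : ι → ℝ) 1) := isCompact_sphere _ _
  have hpos : ∀ x ∈ Metric.sphere (0 : ι → ℝ) 1, 0 < NF (L x) ^ p := by
    intro x hx
    refine Real.rpow_pos_of_pos (lt_of_le_of_ne (hNF0 _) fun h => ?_) _
    have hx0 : x = 0 := by simpa using (hNFdef _).1 h.symm
    simp [hx0] at hx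
  obtain ⟨m, hm0, hm⟩ := hS.exists_forall_le' hcont.continuousOn hpos
  set η : ℝ := (δ * m / (2 * (M + 1))) ^ (1 / p) with hη
  have hbase : 0 < δ * m / (2 * (M + 1)) := by positivity
  have hη0 : 0 < η := Real.rpow_pos_of_pos hbase _
  have hηp : 2 * (M * η ^ p) ≤ δ * m := by
    rw [hη, ← Real.rpow_mul hbase.le, one_div_mul_cancel hp.ne', Real.rpow_one]
    have h1 : 2 * (M * (δ * m / (2 * (M + 1)))) = δ * m * (M / (M + 1)) := by
      field_simp
    rw [h1]
    refine mul_le_of_le_one_right (by positivity) ?_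
    rw [div_le_one (by positivity)]
    linarith
  obtain ⟨T, -, hTfin, hT⟩ := hS.finite_cover_balls hη0
  refine ⟨L '' T, hTfin.image _, fun v hv => ?_⟩
  set x := b.equivFun v with hx
  have hLx : L x = v := by simp [hL, hx]
  have hx0 : x ≠ 0 := by simpa [hx] using hv
  have hnx : 0 < ‖x‖ := norm_pos_iff.2 hx0
  set u := ‖x‖⁻¹ • x with hu
  have hxu : x = ‖x‖ • u := by rw [hu, smul_inv_smul₀ hnx.ne']
  have huS : u ∈ Metric.sphere (0 : ι → ℝ) 1 := by
    simp [hu, norm_smul, hnx.ne']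
  obtain ⟨g, hgT, hg⟩ := Set.mem_iUnion₂.1 (hT huS)
  rw [Metric.mem_ball, dist_eq_norm] at hg
  refine ⟨‖x‖, L g, ‖x‖ • (u - g), Set.mem_image_of_mem _ hgT, ?_, ?_⟩
  · rw [← hLapp, ← map_smul, ← map_add, ← smul_add, add_sub_cancel, ← hxu, hLx]
  · have h1 : NF (L g) ^ p ≤ NF (L u) ^ p + M * η ^ p := by
      have h2 := hdiff g u
      rw [norm_sub_rev] at h2
      have h3 : M * ‖u - g‖ ^ p ≤ M * η ^ p := by gcongr
      linarith
    have h2 := hsum (u - g) η hg.le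
    have h3 : NF (L g) ^ p + ∑ j, NF ((u - g) j • b j) ^ p ≤ (1 + δ) * NF (L u) ^ p := by
      have := mul_le_mul_of_nonneg_left (hm u huS) hδ.le
      linarith
    have hscale : ∀ w : F, NF (‖x‖ • w) ^ p = ‖x‖ ^ p * NF w ^ p := fun w => by
      rw [hNFhom, abs_of_pos hnx, Real.mul_rpow hnx.le (hNF0 _)]
    have hvu : NF v ^ p = ‖x‖ ^ p * NF (L u) ^ p := by
      rw [← hscale, ← map_smul, ← hxu, hLx]
    have h4 : ∑ j, NF ((‖x‖ • (u - g)) j • b j) ^ p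
        = ‖x‖ ^ p * ∑ j, NF ((u - g) j • b j) ^ p := by
      rw [Finset.mul_sum]
      refine Finset.sum_congr rfl fun j _ => ?_
      rw [← hscale, Pi.smul_apply, smul_assoc]
    rw [hscale, h4, hvu, ← mul_add, mul_left_comm]
    exact mul_le_mul_of_nonneg_left h3 (Real.rpow_nonneg hnx.le _)

/-- A map within `C ≥ K` of a `p`-linear map with constant `K` is `p`-linear with constant
`3 ^ (1 / p) * C`. -/
theorem pLinear_of_close {F Y : Type*} [AddCommGroup F] [AddCommGroup Y]
    {NF : F → ℝ} {NY : Y → ℝ} {p K C : ℝ} (hp : 0 < p) (hK : 0 ≤ K) (hKC : K ≤ C)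
    (hNF0 : ∀ x, 0 ≤ NF x) (hNFz : NF 0 = 0)
    (hNFp : ∀ x x', NF (x + x') ^ p ≤ NF x ^ p + NF x' ^ p)
    (hNY0 : ∀ y, 0 ≤ NY y) (hNYz : NY 0 = 0) (hNYneg : ∀ y, NY (-y) = NY y)
    (hNYp : ∀ y y', NY (y + y') ^ p ≤ NY y ^ p + NY y' ^ p)
    {ι : Type*} [Fintype ι] {Φ Φ' : F → Y} (x : ι → F)
    (hΦ : NY (Φ (∑ i, x i) - ∑ i, Φ (x i)) ≤ K * (∑ i, NF (x i) ^ p) ^ (1 / p))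
    (hclose : ∀ f, NY (Φ f - Φ' f) ≤ C * NF f) :
    NY (Φ' (∑ i, x i) - ∑ i, Φ' (x i)) ≤ 3 ^ (1 / p) * C * (∑ i, NF (x i) ^ p) ^ (1 / p) := by
  set S := ∑ i, NF (x i) ^ p with hS
  have hC : 0 ≤ C := hK.trans hKC
  have hS0 : 0 ≤ S := Finset.sum_nonneg fun i _ => Real.rpow_nonneg (hNF0 _) _
  have hclose' : ∀ f, NY (Φ f - Φ' f) ^ p ≤ C ^ p * NF f ^ p := fun f => by
    rw [← Real.mul_rpow hC (hNF0 _)]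
    exact Real.rpow_le_rpow (hNY0 _) (hclose f) hp.le
  have h1 : NY (-(Φ (∑ i, x i) - Φ' (∑ i, x i))) ^ p ≤ C ^ p * S := by
    rw [hNYneg]
    exact (hclose' _).trans (mul_le_mul_of_nonneg_left
      (rpow_sum_le_sum_rpow hp hNFz hNFp _ _) (Real.rpow_nonneg hC _))
  have h2 : NY (Φ (∑ i, x i) - ∑ i, Φ (x i)) ^ p ≤ C ^ p * S := by
    have h := hΦ.trans (mul_le_mul_of_nonneg_right hKC (Real.rpow_nonneg hS0 (1 / p)))
    refine (Real.rpow_le_rpow (hNY0 _) h hp.le).trans_eq ?_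
    rw [Real.mul_rpow hC (Real.rpow_nonneg hS0 _), ← Real.rpow_mul hS0,
      one_div_mul_cancel hp.ne', Real.rpow_one]
  have h3 : NY (∑ i, (Φ (x i) - Φ' (x i))) ^ p ≤ C ^ p * S := by
    refine (rpow_sum_le_sum_rpow hp hNYz hNYp _ _).trans ?_
    rw [hS, Finset.mul_sum]
    exact Finset.sum_le_sum fun i _ => hclose' _
  have hdecomp : Φ' (∑ i, x i) - ∑ i, Φ' (x i) =
      (-(Φ (∑ i, x i) - Φ' (∑ i, x i)) + (Φ (∑ i, x i) - ∑ i, Φ (x i)))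
        + ∑ i, (Φ (x i) - Φ' (x i)) := by
    rw [Finset.sum_sub_distrib]
    abel
  have htot : NY (Φ' (∑ i, x i) - ∑ i, Φ' (x i)) ^ p ≤ 3 * C ^ p * S := by
    rw [hdecomp]
    have h4 := hNYp (-(Φ (∑ i, x i) - Φ' (∑ i, x i)) + (Φ (∑ i, x i) - ∑ i, Φ (x i)))
      (∑ i, (Φ (x i) - Φ' (x i)))
    have h5 := hNYp (-(Φ (∑ i, x i) - Φ' (∑ i, x i))) (Φ (∑ i, x i) - ∑ i, Φ (x i))
    linarith
  have hroot := Real.rpow_le_rpow (Real.rpow_nonneg (hNY0 _) _) htot (one_div_nonneg.2 hp.le)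
  rwa [← Real.rpow_mul (hNY0 _), mul_one_div_cancel hp.ne', Real.rpow_one,
    Real.mul_rpow (by positivity) hS0, Real.mul_rpow (by norm_num) (Real.rpow_nonneg hC _),
    ← Real.rpow_mul hC, mul_one_div_cancel hp.ne', Real.rpow_one] at hroot

/-- Approximation of `p`-linear maps on finite-dimensional spaces: any `p`-linear
`Φ : F → Y` with constant `K` admits, for each `ε > 0`, a homogeneous `Φ'` that is
uniformly `(1+ε)K`-close to `Φ`, has range spanning a finite-dimensional subspace,
and is `p`-linear with constant at most `3^(1/p)(1+ε)K`. -/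
theorem approx_p_linear_fin_dim (p K ε : ℝ) (hp0 : 0 < p) (hp1 : p ≤ 1)
    (hK : 0 ≤ K) (hε : 0 < ε)
    (F : Type*) [AddCommGroup F] [Module ℝ F] [FiniteDimensional ℝ F]
    (Y : Type*) [AddCommGroup Y] [Module ℝ Y]
    (NF : F → ℝ) (NY : Y → ℝ)
    (hNF0 : ∀ x, 0 ≤ NF x) (hNFdef : ∀ x, NF x = 0 ↔ x = 0)
    (hNFhom : ∀ (c : ℝ) (x : F), NF (c • x) = |c| * NF x)
    (hNFp : ∀ x x', NF (x + x') ^ p ≤ NF x ^ p + NF x' ^ p)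
    (hNY0 : ∀ y, 0 ≤ NY y) (hNYdef : ∀ y, NY y = 0 ↔ y = 0)
    (hNYhom : ∀ (c : ℝ) (y : Y), NY (c • y) = |c| * NY y)
    (hNYp : ∀ y y', NY (y + y') ^ p ≤ NY y ^ p + NY y' ^ p)
    (Φ : F → Y)
    (hΦhom : ∀ (c : ℝ) (x : F), Φ (c • x) = c • Φ x)
    (hΦK : ∀ (n : ℕ) (x : Fin n → F),
      NY (Φ (∑ i, x i) - ∑ i, Φ (x i)) ≤ K * (∑ i, NF (x i) ^ p) ^ (1 / p)) :
    ∃ Φ' : F → Y,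
      (∀ (c : ℝ) (x : F), Φ' (c • x) = c • Φ' x) ∧
      (∀ f : F, NY (Φ f - Φ' f) ≤ (1 + ε) * K * NF f) ∧
      FiniteDimensional ℝ (Submodule.span ℝ (Set.range Φ')) ∧
      (∀ (n : ℕ) (x : Fin n → F),
        NY (Φ' (∑ i, x i) - ∑ i, Φ' (x i)) ≤
          3 ^ (1 / p) * (1 + ε) * K * (∑ i, NF (x i) ^ p) ^ (1 / p)) := by
  have hNFz : NF 0 = 0 := (hNFdef 0).2 rfl
  have hNYz : NY 0 = 0 := (hNYdef 0).2 rfl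
  have hΦz : Φ 0 = 0 := by simpa using hΦhom 0 0
  have hNYneg : ∀ y, NY (-y) = NY y := fun y => by simpa using hNYhom (-1) y
  have hδ : 0 < (1 + ε) ^ p - 1 := sub_pos.2 (Real.one_lt_rpow (by linarith) hp0)
  let b := Module.finBasis ℝ F
  obtain ⟨T, hTfin, hT⟩ := exists_finite_net_basis b hp0 hδ hNF0 hNFdef hNFhom hNFp
  set A : Set Y := Φ '' T ∪ Set.range fun j => Φ (b j) with hA
  have hAfin : A.Finite := (hTfin.image _).union (Set.finite_range _)
  set W := Submodule.span ℝ A with hW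
  have hWfin : FiniteDimensional ℝ W := FiniteDimensional.span_of_finite ℝ hAfin
  have happrox : ∀ v, ∃ y ∈ W, NY (Φ v - y) ≤ (1 + ε) * K * NF v := by
    intro v
    by_cases hv : v = 0
    · exact ⟨0, W.zero_mem, by simp [hv, hΦz, hNYz, hNFz]⟩
    obtain ⟨t, g, c, hg, hvg, hcost⟩ := hT v hv
    refine ⟨Φ (t • g) + ∑ j, Φ (c j • b j), ?_, ?_⟩
    · refine W.add_mem ?_ (W.sum_mem fun j _ => ?_)
      · rw [hΦhom]
        exact W.smul_mem _ (Submodule.subset_span (Or.inl ⟨g, hg, rfl⟩))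
      · rw [hΦhom]
        exact W.smul_mem _ (Submodule.subset_span (Or.inr ⟨j, rfl⟩))
    · have h := hΦK _ (Fin.cons (t • g) fun j => c j • b j)
      simp only [Fin.sum_univ_succ, Fin.cons_zero, Fin.cons_succ] at h
      rw [← hvg] at h
      refine h.trans ?_
      have hcost' : (NF (t • g) ^ p + ∑ j, NF (c j • b j) ^ p) ^ (1 / p) ≤ (1 + ε) * NF v := by
        rw [add_sub_cancel, ← Real.mul_rpow (by linarith) (hNF0 v)] at hcost
        refine (Real.rpow_le_rpow ?_ hcost (one_div_nonneg.2 hp0.le)).trans_eq ?_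
        · exact add_nonneg (Real.rpow_nonneg (hNF0 _) _)
            (Finset.sum_nonneg fun j _ => Real.rpow_nonneg (hNF0 _) _)
        · rw [← Real.rpow_mul (mul_nonneg (by linarith) (hNF0 v)), mul_one_div_cancel hp0.ne',
            Real.rpow_one]
      exact (mul_le_mul_of_nonneg_left hcost' hK).trans_eq (by ring)
  obtain ⟨Φ', hhom, hclose, hmem⟩ := exists_homogeneous_approx hNFhom hNYhom hΦhom W happrox
  refine ⟨Φ', hhom, hclose, ?_, fun n x => ?_⟩
  · exact Submodule.finiteDimensional_of_le
      (Submodule.span_le.2 (Set.range_subset_iff.2 hmem))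
  · rw [mul_assoc _ (1 + ε) K]
    exact pLinear_of_close hp0 hK (le_mul_of_one_le_left hK (by linarith)) hNF0 hNFz hNFp
      hNY0 hNYz hNYneg hNYp x (hΦK n x) hclose
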